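/- Fix 0 ≤ ℓ < u ≤ K and α, β ∈ (0,1). If the thresholds of the gap-intersection rule are chosen as a = |log β| + log K, d = |log β| + log(uK), b = |log α| + log K, c = |log α| + log((K−ℓ)K), then for every A ⊆ [K] with ℓ ≤ |A| ≤ u one has P_A(A ≲ d_GI) ≤ α and P_A(d_GI ≲ A) ≤ β; i.e. the gap-intersection rule belongs to Δ_{α,β}(P_{ℓ,u}). -/

import Mathlib

open MeasureTheory ProbabilityTheory Filter Set
open scoped ENNReal NNReal Topology Classical

noncomputable section

namespace SeqMT

variable {Ω : Type*}

/-- The `m`-th largest value (1-indexed, for `1 ≤ m ≤ K`) among `v 0, …, v (K-1)`. -/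
noncomputable def orderStat {K : ℕ} (v : Fin K → ℝ) (m : ℕ) : ℝ :=
  ((Finset.univ.val.map v).sort (· ≤ ·)).getD (K - m) 0

/-- The number of strictly positive entries of `v`. -/
noncomputable def posCount {K : ℕ} (v : Fin K → ℝ) : ℕ :=
  (Finset.univ.filter fun k => 0 < v k).card

/-- The rank (0-indexed) of stream `k`, ordering by value (descending) with ties broken
by stream index: `rankOf v k = r` means `k = i_{r+1}`. -/
noncomputable def rankOf {K : ℕ} (v : Fin K → ℝ) (k : Fin K) : ℕ :=
  (Finset.univ.filter fun j => v k < v j ∨ (v j = v k ∧ j < k)).card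

/-- The set `{i_1, …, i_m}` of the `m` streams with the largest values. -/
noncomputable def topSet {K : ℕ} (v : Fin K → ℝ) (m : ℕ) : Finset (Fin K) :=
  Finset.univ.filter fun k => rankOf v k < m

/-- First time `n ≥ 1` at which `Q n` holds (`⊤` if it never does). -/
noncomputable def stopTime (Q : ℕ → Ω → Prop) (ω : Ω) : ℕ∞ :=
  sInf {n : ℕ∞ | ∃ m : ℕ, n = (m : ℕ∞) ∧ 1 ≤ m ∧ Q m ω}

/-- The log-likelihood ratio process `λ^{A,C}` of `P_A` versus `P_C`. -/
def llrAC {K : ℕ} (lam : Fin K → ℕ → Ω → ℝ) (A C : Finset (Fin K)) (n : ℕ) (ω : Ω) : ℝ :=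
  ∑ k ∈ A \ C, lam k n ω - ∑ k ∈ C \ A, lam k n ω

/-- The gap rule stopping time `T_G`. -/
noncomputable def gapTime {K : ℕ} (lam : Fin K → ℕ → Ω → ℝ) (m : ℕ) (c : ℝ) : Ω → ℕ∞ :=
  stopTime fun n ω =>
    c ≤ orderStat (fun k => lam k n ω) m - orderStat (fun k => lam k n ω) (m + 1)

/-- The gap rule decision `d_G = {i_1(T_G), …, i_m(T_G)}`. -/
noncomputable def gapDecision {K : ℕ} (lam : Fin K → ℕ → Ω → ℝ) (m : ℕ) (c : ℝ)
    (ω : Ω) : Finset (Fin K) :=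
  topSet (fun k => lam k (gapTime lam m c ω).toNat ω) m

/-- `τ₁` (with the convention `λ^{(0)} = -∞`, so `τ₁ = ∞` when `ℓ = 0`). -/
noncomputable def tau1 {K : ℕ} (lam : Fin K → ℕ → Ω → ℝ) (ℓ : ℕ) (a c : ℝ) : Ω → ℕ∞ :=
  stopTime fun n ω => 1 ≤ ℓ ∧ orderStat (fun k => lam k n ω) (ℓ + 1) ≤ -a ∧
    c ≤ orderStat (fun k => lam k n ω) ℓ - orderStat (fun k => lam k n ω) (ℓ + 1)

/-- `τ₂`. -/
noncomputable def tau2 {K : ℕ} (lam : Fin K → ℕ → Ω → ℝ) (ℓ u : ℕ) (a b : ℝ) : Ω → ℕ∞ :=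
  stopTime fun n ω => ℓ ≤ posCount (fun k => lam k n ω) ∧ posCount (fun k => lam k n ω) ≤ u ∧
    ∀ k : Fin K, lam k n ω ∉ Set.Ioo (-a) b

/-- `τ₃` (with the convention `λ^{(K+1)} = ∞`, so `τ₃ = ∞` when `u = K`). -/
noncomputable def tau3 {K : ℕ} (lam : Fin K → ℕ → Ω → ℝ) (u : ℕ) (b d : ℝ) : Ω → ℕ∞ :=
  stopTime fun n ω => u < K ∧ b ≤ orderStat (fun k => lam k n ω) u ∧
    d ≤ orderStat (fun k => lam k n ω) u - orderStat (fun k => lam k n ω) (u + 1)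

/-- The gap-intersection stopping time `T_GI = min{τ₁, τ₂, τ₃}`. -/
noncomputable def giTime {K : ℕ} (lam : Fin K → ℕ → Ω → ℝ) (ℓ u : ℕ) (a b c d : ℝ) :
    Ω → ℕ∞ := fun ω =>
  min (tau1 lam ℓ a c ω) (min (tau2 lam ℓ u a b ω) (tau3 lam u b d ω))

/-- The gap-intersection decision `d_GI = {i_1(T_GI), …, i_{p'}(T_GI)}`,
`p' = min(max(p(T_GI), ℓ), u)`. -/
noncomputable def giDecision {K : ℕ} (lam : Fin K → ℕ → Ω → ℝ) (ℓ u : ℕ) (a b c d : ℝ)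
    (ω : Ω) : Finset (Fin K) :=
  topSet (fun k => lam k (giTime lam ℓ u a b c d ω).toNat ω)
    (min (max (posCount (fun k => lam k (giTime lam ℓ u a b c d ω).toNat ω)) ℓ) u)

/-- The intersection rule stopping time `T_I`. -/
noncomputable def interTime {K : ℕ} (lam : Fin K → ℕ → Ω → ℝ) (a b : ℝ) : Ω → ℕ∞ :=
  stopTime fun n ω => ∀ k : Fin K, lam k n ω ∉ Set.Ioo (-a) b

/-- The intersection rule decision `d_I`: streams with positive LLR at `T_I`. -/
noncomputable def interDecision {K : ℕ} (lam : Fin K → ℕ → Ω → ℝ) (a b : ℝ)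
    (ω : Ω) : Finset (Fin K) :=
  Finset.univ.filter fun k => 0 < lam k (interTime lam a b ω).toNat ω

/-- `φ(x,y) = x log(x/(1-y)) + (1-x) log((1-x)/y)`. -/
noncomputable def phi (x y : ℝ) : ℝ :=
  x * Real.log (x / (1 - y)) + (1 - x) * Real.log ((1 - x) / y)

/-- `γ_{A,C}(α,β)`. -/
noncomputable def gammaAC {K : ℕ} (A C : Finset (Fin K)) (α β : ℝ) : ℝ :=
  if (C \ A).Nonempty ∧ A \ C = ∅ then phi α β
  else if C \ A = ∅ ∧ (A \ C).Nonempty then phi β α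
  else max (phi α β) (phi β α)

/-- `min_{k ∈ S} D k`, as an extended nonnegative real (so `= ∞` when `S = ∅`). -/
noncomputable def eta {K : ℕ} (S : Finset (Fin K)) (D : Fin K → ℝ) : ℝ≥0∞ :=
  S.inf fun k => ENNReal.ofReal (D k)

/-- `T` is a stopping time of the filtration `F`. -/
def IsST (F : ℕ → MeasurableSpace Ω) (T : Ω → ℕ∞) : Prop :=
  ∀ n : ℕ, MeasurableSet[F n] {ω | T ω ≤ (n : ℕ∞)}

/-- `d` is an `F_T`-measurable decision. -/
def IsDecision {K : ℕ} (F : ℕ → MeasurableSpace Ω) (T : Ω → ℕ∞)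
    (d : Ω → Finset (Fin K)) : Prop :=
  ∀ (n : ℕ) (B : Finset (Fin K)), MeasurableSet[F n] {ω | d ω = B ∧ T ω = (n : ℕ∞)}

/-- `(T,d) ∈ Δ_{α,β}(Pcl)`: both familywise error probabilities are controlled for all `A ∈ Pcl`. -/
def InDelta {K : ℕ} [MeasurableSpace Ω] (P : Finset (Fin K) → Measure Ω) (Pcl : Set (Finset (Fin K)))
    (α β : ℝ) (T : Ω → ℕ∞) (d : Ω → Finset (Fin K)) : Prop :=
  ∀ A ∈ Pcl, (P A {ω | ¬ d ω ⊆ A}).toReal ≤ α ∧ (P A {ω | ¬ A ⊆ d ω}).toReal ≤ β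

/-- `inf_{(T,d) ∈ Δ_{α,β}(Pcl)} E_A[T]`. -/
noncomputable def optESS {K : ℕ} [MeasurableSpace Ω] (P : Finset (Fin K) → Measure Ω)
    (F : ℕ → MeasurableSpace Ω) (Pcl : Set (Finset (Fin K))) (α β : ℝ)
    (A : Finset (Fin K)) : ℝ≥0∞ :=
  ⨅ (T : Ω → ℕ∞) (d : Ω → Finset (Fin K))
    (_ : IsST F T ∧ IsDecision F T d ∧ InDelta P Pcl α β T d),
      ∫⁻ ω, (T ω : ℝ≥0∞) ∂ P A

end SeqMT

namespace SeqMT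

section Helpers

variable {Ω : Type*}

lemma countP_sort {K : ℕ} (v : Fin K → ℝ) (q : ℝ → Prop) :
    (Finset.univ.filter fun k => q (v k)).card
      = ((Finset.univ.val.map v).sort (· ≤ ·)).countP (fun x => decide (q x)) := by
  have h1 : Multiset.countP q (((Finset.univ.val.map v).sort (· ≤ ·) : List ℝ) : Multiset ℝ)
      = (Finset.univ.filter fun k => q (v k)).card := by
    rw [Multiset.sort_eq, Multiset.countP_map]
    rfl
  rw [← h1, Multiset.coe_countP]

lemma sort_len {K : ℕ} (v : Fin K → ℝ) :
    ((Finset.univ.val.map v).sort (· ≤ ·)).length = K := by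
  simp

lemma le_card_ge_orderStat {K : ℕ} (v : Fin K → ℝ) {m : ℕ} (h1 : 1 ≤ m) (hm : m ≤ K) :
    m ≤ (Finset.univ.filter fun k => orderStat v m ≤ v k).card := by
  rw [countP_sort v (fun x => orderStat v m ≤ x)]
  unfold orderStat
  have hs := Multiset.pairwise_sort (Finset.univ.val.map v) (· ≤ ·)
  have hl := sort_len v
  generalize (Finset.univ.val.map v).sort (· ≤ ·) = s at hs hl
  have hlt : K - m < s.length := by omega
  rw [← List.getElem_eq_getD (h := hlt)]
  have hd : List.countP (fun x => decide (s[K - m] ≤ x)) (s.drop (K - m)) = m := by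
    rw [List.countP_eq_length.2]
    · rw [List.length_drop]; omega
    · intro x hx
      obtain ⟨i, hi, rfl⟩ := List.mem_iff_getElem.1 hx
      rw [List.getElem_drop]
      rw [List.length_drop] at hi
      simp only [decide_eq_true_eq]
      rcases Nat.eq_zero_or_pos i with h | h
      · subst h; simp
      · exact List.pairwise_iff_getElem.1 hs _ _ _ _ (by omega)
  calc m = _ := hd.symm
    _ ≤ _ := (List.drop_sublist _ _).countP_le

lemma card_gt_orderStat_lt {K : ℕ} (v : Fin K → ℝ) {m : ℕ} (h1 : 1 ≤ m) (hm : m ≤ K) :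
    (Finset.univ.filter fun k => orderStat v m < v k).card < m := by
  rw [countP_sort v (fun x => orderStat v m < x)]
  unfold orderStat
  have hs := Multiset.pairwise_sort (Finset.univ.val.map v) (· ≤ ·)
  have hl := sort_len v
  generalize (Finset.univ.val.map v).sort (· ≤ ·) = s at hs hl
  have hlt : K - m < s.length := by omega
  rw [← List.getElem_eq_getD (h := hlt)]
  have ht : List.countP (fun x => decide (s[K - m] < x)) (s.take (K - m + 1)) = 0 := by
    rw [List.countP_eq_zero]
    intro x hx
    obtain ⟨i, hi, rfl⟩ := List.mem_iff_getElem.1 hx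
    rw [List.getElem_take]
    rw [List.length_take] at hi
    simp only [decide_eq_true_eq, not_lt]
    rcases Nat.lt_or_ge i (K - m) with h | h
    · exact List.pairwise_iff_getElem.1 hs _ _ _ _ h
    · have : i = K - m := by omega
      subst this; exact le_rfl
  have hsplit := List.countP_append (p := fun x => decide (s[K - m] < x))
    (l₁ := s.take (K - m + 1)) (l₂ := s.drop (K - m + 1))
  rw [List.take_append_drop, ht] at hsplit
  have hle := List.countP_le_length (p := fun x => decide (s[K - m] < x))
    (l := s.drop (K - m + 1))
  rw [List.length_drop] at hle
  omega

lemma mem_topSet {K : ℕ} (v : Fin K → ℝ) (m : ℕ) (k : Fin K) :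
    k ∈ topSet v m ↔ rankOf v k < m := by
  simp [topSet]

lemma topSet_ge {K : ℕ} (v : Fin K → ℝ) {m : ℕ} (h1 : 1 ≤ m) (hm : m ≤ K) {k : Fin K}
    (hk : k ∈ topSet v m) : orderStat v m ≤ v k := by
  by_contra hlt
  push Not at hlt
  have h := le_card_ge_orderStat v h1 hm
  rw [mem_topSet] at hk
  unfold rankOf at hk
  have : (Finset.univ.filter fun k => orderStat v m ≤ v k).card ≤
      (Finset.univ.filter fun j => v k < v j ∨ (v j = v k ∧ j < k)).card := by
    apply Finset.card_le_card
    intro j hj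
    simp only [Finset.mem_filter, Finset.mem_univ, true_and] at hj ⊢
    exact Or.inl (lt_of_lt_of_le hlt hj)
  omega

lemma not_topSet_le {K : ℕ} (v : Fin K → ℝ) {m : ℕ} (hm : m + 1 ≤ K) {k : Fin K}
    (hk : k ∉ topSet v m) : v k ≤ orderStat v (m + 1) := by
  by_contra hlt
  push Not at hlt
  have h := card_gt_orderStat_lt v (Nat.le_add_left 1 m) hm
  rw [mem_topSet, not_lt] at hk
  unfold rankOf at hk
  have : (Finset.univ.filter fun j => v k < v j ∨ (v j = v k ∧ j < k)).card <
      (Finset.univ.filter fun k => orderStat v (m + 1) < v k).card := by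
    apply Finset.card_lt_card
    rw [Finset.ssubset_iff_of_subset]
    · exact ⟨k, by simpa using hlt, by simp⟩
    · intro j hj
      simp only [Finset.mem_filter, Finset.mem_univ, true_and] at hj ⊢
      rcases hj with hj | hj
      · linarith
      · linarith [hj.1]
  omega

lemma rankOf_lt {K : ℕ} (v : Fin K → ℝ) (k : Fin K) : rankOf v k < K := by
  have : (Finset.univ.filter fun j => v k < v j ∨ (v j = v k ∧ j < k)).card <
      (Finset.univ : Finset (Fin K)).card := by
    apply Finset.card_lt_card
    rw [Finset.ssubset_iff_of_subset (Finset.filter_subset _ _)]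
    exact ⟨k, by simp, by simp⟩
  simpa [rankOf] using this

lemma rankOf_lt_of {K : ℕ} (v : Fin K → ℝ) {i k : Fin K}
    (h : v k < v i ∨ (v i = v k ∧ i < k)) : rankOf v i < rankOf v k := by
  unfold rankOf
  apply Finset.card_lt_card
  rw [Finset.ssubset_iff_of_subset]
  · exact ⟨i, by simpa using h, by simp⟩
  · intro j hj
    simp only [Finset.mem_filter, Finset.mem_univ, true_and] at hj ⊢
    rcases h with h | h <;> rcases hj with hj | hj
    · exact Or.inl (h.trans hj)
    · exact Or.inl (by rw [hj.1]; exact h)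
    · exact Or.inl (by rw [← h.1]; exact hj)
    · exact Or.inr ⟨hj.1.trans h.1, hj.2.trans h.2⟩

lemma rankOf_inj {K : ℕ} (v : Fin K → ℝ) : Function.Injective (rankOf v) := by
  intro i k hik
  by_contra hne
  rcases lt_trichotomy (v i) (v k) with h | h | h
  · exact absurd (rankOf_lt_of v (i := k) (k := i) (Or.inl h)) (by omega)
  · rcases lt_or_gt_of_ne hne with hx2 | hx2
    · exact absurd (rankOf_lt_of v (i := i) (k := k) (Or.inr ⟨h, hx2⟩)) (by omega)
    · exact absurd (rankOf_lt_of v (i := k) (k := i) (Or.inr ⟨h.symm, hx2⟩)) (by omega)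
  · exact absurd (rankOf_lt_of v (i := i) (k := k) (Or.inl h)) (by omega)

lemma card_topSet {K : ℕ} (v : Fin K → ℝ) {m : ℕ} (hm : m ≤ K) : (topSet v m).card = m := by
  have himg : (Finset.univ : Finset (Fin K)).image (rankOf v) = Finset.range K := by
    apply Finset.eq_of_subset_of_card_le
    · intro r hr
      obtain ⟨k, -, rfl⟩ := Finset.mem_image.1 hr
      exact Finset.mem_range.2 (rankOf_lt v k)
    · rw [Finset.card_image_of_injective _ (rankOf_inj v)]; simp
  have h2 : (topSet v m).image (rankOf v) = Finset.range m := by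
    ext r
    simp only [topSet, Finset.mem_image, Finset.mem_filter, Finset.mem_univ, true_and,
      Finset.mem_range]
    constructor
    · rintro ⟨k, hk, rfl⟩; exact hk
    · intro hr
      have : r ∈ Finset.range K := Finset.mem_range.2 (by omega)
      rw [← himg] at this
      obtain ⟨k, -, rfl⟩ := Finset.mem_image.1 this
      exact ⟨k, hr, rfl⟩
  rw [← Finset.card_image_of_injective _ (rankOf_inj v), h2, Finset.card_range]

lemma mem_topSet_posCount {K : ℕ} (v : Fin K → ℝ) (k : Fin K) :
    k ∈ topSet v (posCount v) ↔ 0 < v k := by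
  rw [mem_topSet]
  unfold rankOf posCount
  constructor
  · intro h
    by_contra hk
    push Not at hk
    refine absurd h (not_lt.2 (Finset.card_le_card ?_))
    intro j hj
    simp only [Finset.mem_filter, Finset.mem_univ, true_and] at hj ⊢
    exact Or.inl (lt_of_le_of_lt hk hj)
  · intro h
    apply Finset.card_lt_card
    rw [Finset.ssubset_iff_of_subset]
    · exact ⟨k, by simpa using h, by simp⟩
    · intro j hj
      simp only [Finset.mem_filter, Finset.mem_univ, true_and] at hj ⊢
      rcases hj with hj | hj
      · linarith
      · linarith [hj.1]

lemma posCount_le {K : ℕ} (v : Fin K → ℝ) {m : ℕ} (hm : m + 1 ≤ K)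
    (h : orderStat v (m + 1) ≤ 0) : posCount v ≤ m := by
  have h1 := card_gt_orderStat_lt v (Nat.le_add_left 1 m) hm
  have : posCount v ≤ (Finset.univ.filter fun k => orderStat v (m + 1) < v k).card := by
    apply Finset.card_le_card
    intro j hj
    simp only [Finset.mem_filter, Finset.mem_univ, true_and] at hj ⊢
    linarith
  omega

lemma le_posCount {K : ℕ} (v : Fin K → ℝ) {m : ℕ} (h1 : 1 ≤ m) (hm : m ≤ K)
    (h : 0 < orderStat v m) : m ≤ posCount v := by
  refine (le_card_ge_orderStat v h1 hm).trans ?_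
  apply Finset.card_le_card
  intro j hj
  simp only [Finset.mem_filter, Finset.mem_univ, true_and] at hj ⊢
  linarith

lemma stopTime_spec (Q : ℕ → Ω → Prop) (ω : Ω) (h : stopTime Q ω ≠ ⊤) :
    Q (stopTime Q ω).toNat ω := by
  have hne : {n : ℕ∞ | ∃ m : ℕ, n = (m : ℕ∞) ∧ 1 ≤ m ∧ Q m ω}.Nonempty := by
    by_contra hc
    rw [Set.not_nonempty_iff_eq_empty] at hc
    exact h (by rw [stopTime, hc, sInf_empty])
  obtain ⟨m, hm, -, hQ⟩ := csInf_mem hne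
  have : stopTime Q ω = (m : ℕ∞) := hm
  rw [this]
  simpa using hQ

lemma stopTime_ne_top (Q : ℕ → Ω → Prop) (ω : Ω) {n : ℕ} (hn : 1 ≤ n) (h : Q n ω) :
    stopTime Q ω ≠ ⊤ := by
  have : stopTime Q ω ≤ (n : ℕ∞) := sInf_le ⟨n, rfl, hn, h⟩
  exact ne_top_of_le_ne_top (ENat.natCast_ne_top n) this

/-- Deterministic consequences of stopping at a finite time. -/
lemma gi_cases {K : ℕ} (lam : Fin K → ℕ → Ω → ℝ) (ℓ u : ℕ) (a b c d : ℝ)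
    (hℓu : ℓ < u) (huK : u ≤ K) (ha : 0 < a) (hb : 0 < b) (ω : Ω)
    (hfin : giTime lam ℓ u a b c d ω ≠ ⊤) (A : Finset (Fin K))
    (hA1 : ℓ ≤ A.card) (hA2 : A.card ≤ u) :
    (¬ giDecision lam ℓ u a b c d ω ⊆ A → ∃ j, j ∉ A ∧ ((∃ n, b ≤ lam j n ω) ∨
      ∃ i ∈ A, ∃ n, c ≤ lam j n ω - lam i n ω)) ∧
    (¬ A ⊆ giDecision lam ℓ u a b c d ω → ∃ i ∈ A, ((∃ n, a ≤ - lam i n ω) ∨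
      ∃ j, j ∉ A ∧ ∃ n, d ≤ lam j n ω - lam i n ω)) := by
  have hcase : giTime lam ℓ u a b c d ω = tau1 lam ℓ a c ω ∨
      giTime lam ℓ u a b c d ω = tau2 lam ℓ u a b ω ∨
      giTime lam ℓ u a b c d ω = tau3 lam u b d ω := by
    unfold giTime
    rcases min_choice (tau1 lam ℓ a c ω) (min (tau2 lam ℓ u a b ω) (tau3 lam u b d ω)) with h | h
    · exact Or.inl h
    · rw [h]; exact Or.inr (min_choice _ _)
  unfold giDecision
  have hQ : let n := (giTime lam ℓ u a b c d ω).toNat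
      (1 ≤ ℓ ∧ orderStat (fun k => lam k n ω) (ℓ + 1) ≤ -a ∧
        c ≤ orderStat (fun k => lam k n ω) ℓ - orderStat (fun k => lam k n ω) (ℓ + 1)) ∨
      (ℓ ≤ posCount (fun k => lam k n ω) ∧ posCount (fun k => lam k n ω) ≤ u ∧
        ∀ k : Fin K, lam k n ω ∉ Set.Ioo (-a) b) ∨
      (u < K ∧ b ≤ orderStat (fun k => lam k n ω) u ∧
        d ≤ orderStat (fun k => lam k n ω) u - orderStat (fun k => lam k n ω) (u + 1)) := by
    intro n
    rcases hcase with h | h | h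
    · left
      have := stopTime_spec _ ω (h ▸ hfin : tau1 lam ℓ a c ω ≠ ⊤)
      simp only [n, h]; exact this
    · right; left
      have := stopTime_spec _ ω (h ▸ hfin : tau2 lam ℓ u a b ω ≠ ⊤)
      simp only [n, h]; exact this
    · right; right
      have := stopTime_spec _ ω (h ▸ hfin : tau3 lam u b d ω ≠ ⊤)
      simp only [n, h]; exact this
  generalize (giTime lam ℓ u a b c d ω).toNat = n at hQ ⊢
  simp only at hQ
  rcases hQ with ⟨h1, h2, h3⟩ | ⟨h1, h2, h3⟩ | ⟨h1, h2, h3⟩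
  · have hp := posCount_le (fun k => lam k n ω) (m := ℓ) (by omega) (by linarith)
    rw [max_eq_right hp, min_eq_left hℓu.le]
    have hcard := card_topSet (fun k => lam k n ω) (m := ℓ) (by omega)
    constructor
    · intro hns
      have : ∃ i ∈ A, i ∉ topSet (fun k => lam k n ω) ℓ := by
        by_contra hc
        push Not at hc
        exact hns (Finset.eq_of_subset_of_card_le hc (by omega)).ge
      obtain ⟨i, hiA, hi⟩ := this
      obtain ⟨j, hj, hjA⟩ := Finset.not_subset.1 hns
      have e1 := topSet_ge _ h1 (by omega) hj
      have e2 := not_topSet_le _ (by omega) hi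
      exact ⟨j, hjA, Or.inr ⟨i, hiA, n, by linarith⟩⟩
    · intro hns
      obtain ⟨i, hiA, hi⟩ := Finset.not_subset.1 hns
      have e2 := not_topSet_le _ (by omega) hi
      exact ⟨i, hiA, Or.inl ⟨n, by linarith⟩⟩
  · rw [max_eq_left h1, min_eq_left h2]
    constructor
    · intro hns
      obtain ⟨j, hj, hjA⟩ := Finset.not_subset.1 hns
      rw [mem_topSet_posCount] at hj
      refine ⟨j, hjA, Or.inl ⟨n, ?_⟩⟩
      by_contra hlt
      push Not at hlt
      exact h3 j ⟨by linarith, hlt⟩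
    · intro hns
      obtain ⟨i, hiA, hi⟩ := Finset.not_subset.1 hns
      rw [mem_topSet_posCount] at hi
      push Not at hi
      refine ⟨i, hiA, Or.inl ⟨n, ?_⟩⟩
      by_contra hlt
      push Not at hlt
      exact h3 i ⟨by linarith, by linarith⟩
  · have hp := le_posCount (fun k => lam k n ω) (m := u) (by omega) huK (by linarith)
    rw [max_eq_left (by omega), min_eq_right hp]
    have hcard := card_topSet (fun k => lam k n ω) (m := u) (by omega)
    constructor
    · intro hns
      obtain ⟨j, hj, hjA⟩ := Finset.not_subset.1 hns
      have e1 := topSet_ge _ (by omega) huK hj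
      exact ⟨j, hjA, Or.inl ⟨n, by linarith⟩⟩
    · intro hns
      have : ∃ j ∈ topSet (fun k => lam k n ω) u, j ∉ A := by
        by_contra hc
        push Not at hc
        exact hns (Finset.eq_of_subset_of_card_le hc (by omega)).ge
      obtain ⟨j, hj, hjA⟩ := this
      obtain ⟨i, hiA, hi⟩ := Finset.not_subset.1 hns
      have e1 := topSet_ge _ (by omega) huK hj
      have e2 := not_topSet_le _ (by omega) hi
      exact ⟨i, hiA, Or.inr ⟨j, hjA, n, by linarith⟩⟩

lemma meas_llr [MeasurableSpace Ω] {K : ℕ} (lam : Fin K → ℕ → Ω → ℝ) (n : ℕ)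
    (h : ∀ k, Measurable fun ω => lam k n ω) (A C : Finset (Fin K)) (x : ℝ) :
    MeasurableSet {ω | x ≤ - llrAC lam A C n ω} := by
  unfold llrAC
  refine measurableSet_le measurable_const (Measurable.neg (Measurable.sub ?_ ?_))
  · exact Finset.measurable_fun_sum _ (fun k _ => h k)
  · exact Finset.measurable_fun_sum _ (fun k _ => h k)

/-- Maximal inequality for the likelihood ratio. -/
lemma ville [MeasurableSpace Ω] {K : ℕ}
    (F : ℕ → MeasurableSpace Ω) (hFle : ∀ n, F n ≤ ‹MeasurableSpace Ω›)
    (hFmono : Monotone F)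
    (P : Finset (Fin K) → Measure Ω) [∀ A : Finset (Fin K), IsProbabilityMeasure (P A)]
    (lam : Fin K → ℕ → Ω → ℝ)
    (hadapt : ∀ (k : Fin K) (n : ℕ), Measurable[F n] fun ω => lam k n ω)
    (hLR : ∀ (A C : Finset (Fin K)) (n : ℕ) (Γ : Set Ω), MeasurableSet[F n] Γ →
      (P A Γ).toReal = ∫ ω in Γ, Real.exp (llrAC lam A C n ω) ∂ P C)
    (A C : Finset (Fin K)) (x : ℝ) :
    P A {ω | ∃ n, x ≤ - llrAC lam A C n ω} ≤ ENNReal.ofReal (Real.exp (-x)) := by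
  set E : ℕ → Set Ω := fun n => {ω | x ≤ - llrAC lam A C n ω} with hE
  have hEm : ∀ n, MeasurableSet[F n] (E n) := by
    intro n
    exact @meas_llr Ω (F n) K lam n (fun k => hadapt k n) A C x
  have hDm : ∀ n, MeasurableSet[F n] (disjointed E n) := by
    intro n
    rw [disjointed_eq_inter_compl]
    refine MeasurableSet.inter (hEm n) ?_
    refine MeasurableSet.iInter fun i => MeasurableSet.iInter fun hi => ?_
    exact (hFmono hi.le _ (hEm i)).compl
  have hstep : ∀ n, P A (disjointed E n) ≤
      ENNReal.ofReal (Real.exp (-x)) * P C (disjointed E n) := by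
    intro n
    have hint : Integrable (fun ω => Real.exp (llrAC lam A C n ω)) (P C) := by
      by_contra hc
      have := hLR A C n Set.univ MeasurableSet.univ
      rw [Measure.restrict_univ, integral_undef hc] at this
      simp at this
    have hle : (P A (disjointed E n)).toReal ≤ Real.exp (-x) * (P C (disjointed E n)).toReal := by
      rw [hLR A C n _ (hDm n)]
      calc ∫ ω in disjointed E n, Real.exp (llrAC lam A C n ω) ∂ P C
          ≤ ∫ ω in disjointed E n, Real.exp (-x) ∂ P C := by
            refine setIntegral_mono_on hint.integrableOn (by simp) (hFle n _ (hDm n)) ?_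
            intro ω hω
            have : x ≤ - llrAC lam A C n ω := disjointed_subset E n hω
            exact Real.exp_le_exp.2 (by linarith)
        _ = _ := by simp [Measure.real, mul_comm]
    rw [← ENNReal.ofReal_toReal (measure_ne_top (P A) (disjointed E n)),
      ← ENNReal.ofReal_toReal (measure_ne_top (P C) (disjointed E n)),
      ← ENNReal.ofReal_mul (Real.exp_nonneg _)]
    exact ENNReal.ofReal_le_ofReal hle
  have hset : {ω | ∃ n, x ≤ - llrAC lam A C n ω} = ⋃ n, disjointed E n := by
    rw [iUnion_disjointed]; ext ω; simp [hE]
  rw [hset]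
  calc P A (⋃ n, disjointed E n) ≤ ∑' n, P A (disjointed E n) := measure_iUnion_le _
    _ ≤ ∑' n, ENNReal.ofReal (Real.exp (-x)) * P C (disjointed E n) :=
        ENNReal.tsum_le_tsum hstep
    _ = ENNReal.ofReal (Real.exp (-x)) * P C (⋃ n, disjointed E n) := by
        rw [ENNReal.tsum_mul_left, measure_iUnion (disjoint_disjointed E)
          (fun n => hFle n _ (hDm n))]
    _ ≤ ENNReal.ofReal (Real.exp (-x)) * 1 := by gcongr; exact prob_le_one
    _ = _ := mul_one _

/-- Union bound with the two types of events. -/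
lemma union_bound [MeasurableSpace Ω] {ι : Type*} (μ : Measure Ω) [IsProbabilityMeasure μ]
    (S R : Finset ι) (B : Set Ω) (G : ι → Set Ω) (H : ι → ι → Set Ω) (x y : ℝ)
    (hx : 0 ≤ x) (hy : 0 ≤ y)
    (hG : ∀ j ∈ S, μ (G j) ≤ ENNReal.ofReal x)
    (hH : ∀ j ∈ S, ∀ i ∈ R, μ (H j i) ≤ ENNReal.ofReal y)
    (hB : ∀ᵐ ω ∂μ, ω ∈ B → ∃ j ∈ S, ω ∈ G j ∨ ∃ i ∈ R, ω ∈ H j i) :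
    (μ B).toReal ≤ S.card * (x + R.card * y) := by
  have h1 : μ B ≤ μ (⋃ j ∈ S, (G j ∪ ⋃ i ∈ R, H j i)) := by
    apply measure_mono_ae
    filter_upwards [hB] with ω hω hωB
    obtain ⟨j, hj, h⟩ := hω hωB
    refine Set.mem_biUnion hj ?_
    rcases h with h | ⟨i, hi, h⟩
    · exact Or.inl h
    · exact Or.inr (Set.mem_biUnion hi h)
  have h2 : μ B ≤ ENNReal.ofReal (S.card * (x + R.card * y)) := by
    refine h1.trans ((measure_biUnion_finset_le _ _).trans ?_)
    calc ∑ j ∈ S, μ (G j ∪ ⋃ i ∈ R, H j i)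
        ≤ ∑ j ∈ S, ENNReal.ofReal (x + R.card * y) := by
          refine Finset.sum_le_sum fun j hj => (measure_union_le _ _).trans ?_
          rw [ENNReal.ofReal_add hx (by positivity)]
          refine add_le_add (hG j hj) ((measure_biUnion_finset_le _ _).trans ?_)
          refine (Finset.sum_le_sum fun i hi => hH j hj i hi).trans ?_
          rw [Finset.sum_const, nsmul_eq_mul, ENNReal.ofReal_mul (by positivity),
            ENNReal.ofReal_natCast]
      _ = _ := by
          rw [Finset.sum_const, nsmul_eq_mul, ENNReal.ofReal_mul (by positivity),
            ENNReal.ofReal_natCast]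
  exact ENNReal.toReal_le_of_le_ofReal (by positivity) h2

lemma exp_threshold {t z : ℝ} (ht : t ∈ Set.Ioo (0:ℝ) 1) (hz : 0 < z) :
    Real.exp (-(|Real.log t| + Real.log z)) = t / z := by
  rw [abs_of_neg (Real.log_neg ht.1 ht.2)]
  rw [show -(-Real.log t + Real.log z) = Real.log t - Real.log z by ring, Real.exp_sub,
    Real.exp_log ht.1, Real.exp_log hz]

end Helpers

/-- **Gap-intersection rule with the universal thresholds
`a = |log β| + log K`, `d = |log β| + log(uK)`, `b = |log α| + log K`,
`c = |log α| + log((K-ℓ)K)` belongs to `Δ_{α,β}(P_{ℓ,u})`.** -/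
theorem gap_intersection_in_Delta
    {Ω : Type*} [MeasurableSpace Ω] {K : ℕ}
    (F : ℕ → MeasurableSpace Ω) (hFle : ∀ n, F n ≤ ‹MeasurableSpace Ω›)
    (hFmono : Monotone F)
    (P : Finset (Fin K) → Measure Ω) [∀ A : Finset (Fin K), IsProbabilityMeasure (P A)]
    (lam : Fin K → ℕ → Ω → ℝ)
    (hadapt : ∀ (k : Fin K) (n : ℕ), Measurable[F n] fun ω => lam k n ω)
    (hLR : ∀ (A C : Finset (Fin K)) (n : ℕ) (Γ : Set Ω), MeasurableSet[F n] Γ →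
      (P A Γ).toReal = ∫ ω in Γ, Real.exp (llrAC lam A C n ω) ∂ P C)
    (hdiv1 : ∀ (A : Finset (Fin K)) (k : Fin K), k ∈ A →
      ∀ᵐ ω ∂ P A, Tendsto (fun n => lam k n ω) atTop atTop)
    (hdiv0 : ∀ (A : Finset (Fin K)) (k : Fin K), k ∉ A →
      ∀ᵐ ω ∂ P A, Tendsto (fun n => lam k n ω) atTop atBot)
    (ℓ u : ℕ) (hℓu : ℓ < u) (huK : u ≤ K)
    (α β : ℝ) (hα : α ∈ Set.Ioo (0:ℝ) 1) (hβ : β ∈ Set.Ioo (0:ℝ) 1)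
    (a b c d : ℝ)
    (hadef : a = |Real.log β| + Real.log K)
    (hddef : d = |Real.log β| + Real.log ((u : ℝ) * K))
    (hbdef : b = |Real.log α| + Real.log K)
    (hcdef : c = |Real.log α| + Real.log (((K : ℝ) - ℓ) * K)) :
    InDelta P {B : Finset (Fin K) | ℓ ≤ B.card ∧ B.card ≤ u} α β
      (giTime lam ℓ u a b c d) (giDecision lam ℓ u a b c d) := by
  intro A hA
  obtain ⟨hA1, hA2⟩ := hA
  have hK1 : 1 ≤ K := by omega
  have hK : (1:ℝ) ≤ K := by exact_mod_cast hK1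
  have hlogK : 0 ≤ Real.log K := Real.log_nonneg hK
  have ha : 0 < a := by
    rw [hadef]
    have := abs_pos.2 (Real.log_neg hβ.1 hβ.2).ne
    linarith
  have hb : 0 < b := by
    rw [hbdef]
    have := abs_pos.2 (Real.log_neg hα.1 hα.2).ne
    linarith
  have hfin : ∀ᵐ ω ∂ P A, giTime lam ℓ u a b c d ω ≠ ⊤ := by
    have hall : ∀ᵐ ω ∂ P A, ∀ k : Fin K, ∀ᶠ n in atTop,
        (k ∈ A → b ≤ lam k n ω) ∧ (k ∉ A → lam k n ω ≤ -a) := by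
      rw [ae_all_iff]
      intro k
      by_cases hk : k ∈ A
      · filter_upwards [hdiv1 A k hk] with ω hω
        filter_upwards [hω.eventually_ge_atTop b] with n hn
        exact ⟨fun _ => hn, fun h => absurd hk h⟩
      · filter_upwards [hdiv0 A k hk] with ω hω
        filter_upwards [hω.eventually_le_atBot (-a)] with n hn
        exact ⟨fun h => absurd h hk, fun _ => hn⟩
    filter_upwards [hall] with ω hω
    rw [← eventually_all] at hω
    obtain ⟨n, hn, hn1⟩ := (hω.and (eventually_ge_atTop 1)).exists
    have hpos : posCount (fun k => lam k n ω) = A.card := by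
      unfold posCount
      congr 1
      ext k
      simp only [Finset.mem_filter, Finset.mem_univ, true_and]
      constructor
      · intro h
        by_contra hk
        linarith [(hn k).2 hk]
      · intro hk
        linarith [(hn k).1 hk]
    have h2 : tau2 lam ℓ u a b ω ≠ ⊤ := by
      refine stopTime_ne_top _ ω hn1 ?_
      simp only [hpos]
      refine ⟨hA1, hA2, fun k hk => ?_⟩
      by_cases hkA : k ∈ A
      · linarith [(hn k).1 hkA, hk.2]
      · linarith [(hn k).2 hkA, hk.1]
    exact ne_top_of_le_ne_top h2 ((min_le_right _ _).trans (min_le_left _ _))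
  have hV := ville F hFle hFmono P lam hadapt hLR
  have hl1 : ∀ j, j ∉ A → ∀ n ω, - llrAC lam A (insert j A) n ω = lam j n ω := by
    intro j hj n ω
    have e1 : A \ insert j A = ∅ := Finset.sdiff_eq_empty_iff_subset.2 (Finset.subset_insert _ _)
    have e2 : insert j A \ A = {j} := by
      ext k; simp only [Finset.mem_sdiff, Finset.mem_insert, Finset.mem_singleton]
      constructor
      · rintro ⟨h | h, hx2⟩
        · exact h
        · exact absurd h hx2
      · rintro rfl; exact ⟨Or.inl rfl, hj⟩
    simp [llrAC, e1, e2]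
  have hl2 : ∀ i ∈ A, ∀ n ω, - llrAC lam A (A.erase i) n ω = - lam i n ω := by
    intro i hi n ω
    have e1 : A \ A.erase i = {i} := by
      ext k; simp only [Finset.mem_sdiff, Finset.mem_erase, Finset.mem_singleton]
      constructor
      · rintro ⟨h, hx2⟩
        by_contra hne
        exact hx2 ⟨hne, h⟩
      · rintro rfl; exact ⟨hi, fun h => h.1 rfl⟩
    have e2 : A.erase i \ A = ∅ := Finset.sdiff_eq_empty_iff_subset.2 (Finset.erase_subset _ _)
    simp [llrAC, e1, e2]
  have hl3 : ∀ j, j ∉ A → ∀ i ∈ A, ∀ n ω,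
      - llrAC lam A (insert j (A.erase i)) n ω = lam j n ω - lam i n ω := by
    intro j hj i hi n ω
    have hij : i ≠ j := by rintro rfl; exact hj hi
    have e1 : A \ insert j (A.erase i) = {i} := by
      ext k; simp only [Finset.mem_sdiff, Finset.mem_insert, Finset.mem_erase,
        Finset.mem_singleton]
      constructor
      · rintro ⟨h, hx2⟩
        by_contra hne
        exact hx2 (Or.inr ⟨hne, h⟩)
      · rintro rfl
        refine ⟨hi, ?_⟩
        rintro (h | h)
        · exact hij h
        · exact h.1 rfl
    have e2 : insert j (A.erase i) \ A = {j} := by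
      ext k; simp only [Finset.mem_sdiff, Finset.mem_insert, Finset.mem_erase,
        Finset.mem_singleton]
      constructor
      · rintro ⟨h | h, hx2⟩
        · exact h
        · exact absurd h.2 hx2
      · rintro rfl; exact ⟨Or.inl rfl, hj⟩
    simp [llrAC, e1, e2]
  have hV1 : ∀ j, j ∉ A → ∀ x, P A {ω | ∃ n, x ≤ lam j n ω} ≤ ENNReal.ofReal (Real.exp (-x)) := by
    intro j hj x
    have := hV A (insert j A) x
    simpa only [hl1 j hj] using this
  have hV2 : ∀ i ∈ A, ∀ x, P A {ω | ∃ n, x ≤ - lam i n ω} ≤ ENNReal.ofReal (Real.exp (-x)) := by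
    intro i hi x
    have := hV A (A.erase i) x
    simpa only [hl2 i hi] using this
  have hV3 : ∀ j, j ∉ A → ∀ i ∈ A, ∀ x, P A {ω | ∃ n, x ≤ lam j n ω - lam i n ω} ≤
      ENNReal.ofReal (Real.exp (-x)) := by
    intro j hj i hi x
    have := hV A (insert j (A.erase i)) x
    simpa only [hl3 j hj i hi] using this
  have hKpos : (0:ℝ) < K := by linarith
  have hu : (0:ℝ) < u := by exact_mod_cast (by omega : 0 < u)
  have hKl : (0:ℝ) < (K:ℝ) - ℓ := by
    have : (ℓ:ℝ) < K := by exact_mod_cast (by omega : ℓ < K)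
    linarith
  have hcardc : ((Aᶜ).card : ℝ) = K - A.card := by
    have h := Finset.card_add_card_compl A
    rw [Fintype.card_fin] at h
    have hx2 : (A.card : ℝ) + ((Aᶜ).card : ℝ) = K := by exact_mod_cast h
    linarith
  have hm1 : (ℓ:ℝ) ≤ A.card := by exact_mod_cast hA1
  have hm2 : (A.card:ℝ) ≤ u := by exact_mod_cast hA2
  have hmK : (u:ℝ) ≤ K := by exact_mod_cast huK
  have hm0 : (0:ℝ) ≤ A.card := by positivity
  constructor
  · have hub := union_bound (P A) Aᶜ A {ω | ¬ giDecision lam ℓ u a b c d ω ⊆ A}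
      (fun j => {ω | ∃ n, b ≤ lam j n ω}) (fun j i => {ω | ∃ n, c ≤ lam j n ω - lam i n ω})
      (Real.exp (-b)) (Real.exp (-c)) (Real.exp_nonneg _) (Real.exp_nonneg _)
      (fun j hj => hV1 j (Finset.mem_compl.1 hj) b)
      (fun j hj i hi => hV3 j (Finset.mem_compl.1 hj) i hi c)
      (by
        filter_upwards [hfin] with ω hω hB
        obtain ⟨j, hj, h⟩ := (gi_cases lam ℓ u a b c d hℓu huK ha hb ω hω A hA1 hA2).1 hB
        exact ⟨j, Finset.mem_compl.2 hj, h⟩)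
    refine hub.trans ?_
    rw [hbdef, hcdef, exp_threshold hα hKpos, exp_threshold hα (by positivity), hcardc]
    rw [show ((K:ℝ) - A.card) * (α / K + A.card * (α / (((K:ℝ) - ℓ) * K)))
      = α * ((((K:ℝ) - A.card) * ((K - ℓ) + A.card)) / (((K:ℝ) - ℓ) * K)) by
        field_simp]
    have : (((K:ℝ) - A.card) * ((K - ℓ) + A.card)) / (((K:ℝ) - ℓ) * K) ≤ 1 := by
      rw [div_le_one (by positivity)]
      nlinarith [mul_nonneg hm0 (sub_nonneg.2 hm1)]
    exact mul_le_of_le_one_right hα.1.le this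
  · have hub := union_bound (P A) A Aᶜ {ω | ¬ A ⊆ giDecision lam ℓ u a b c d ω}
      (fun i => {ω | ∃ n, a ≤ - lam i n ω}) (fun i j => {ω | ∃ n, d ≤ lam j n ω - lam i n ω})
      (Real.exp (-a)) (Real.exp (-d)) (Real.exp_nonneg _) (Real.exp_nonneg _)
      (fun i hi => hV2 i hi a)
      (fun i hi j hj => hV3 j (Finset.mem_compl.1 hj) i hi d)
      (by
        filter_upwards [hfin] with ω hω hB
        obtain ⟨i, hi, h⟩ := (gi_cases lam ℓ u a b c d hℓu huK ha hb ω hω A hA1 hA2).2 hB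
        refine ⟨i, hi, h.imp id ?_⟩
        rintro ⟨j, hj, h⟩
        exact ⟨j, Finset.mem_compl.2 hj, h⟩)
    refine hub.trans ?_
    rw [hadef, hddef, exp_threshold hβ hKpos, exp_threshold hβ (by positivity), hcardc]
    rw [show (A.card:ℝ) * (β / K + ((K:ℝ) - A.card) * (β / ((u:ℝ) * K)))
      = β * (((A.card:ℝ) * (u + (K - A.card))) / ((u:ℝ) * K)) by
        field_simp]
    have : ((A.card:ℝ) * (u + (K - A.card))) / ((u:ℝ) * K) ≤ 1 := by
      rw [div_le_one (by positivity)]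
      nlinarith [mul_nonneg (sub_nonneg.2 (hm2.trans hmK)) (sub_nonneg.2 hm2)]
    exact mul_le_of_le_one_right hβ.1.le this

end SeqMT
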